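/- arXiv:1505.04884 — 2 statements merged into one kernel-verified Lean document; each statement's English description precedes it below -/
import Mathlib

section
/- Exactness of the symbol sequence for the Rapcsák operator: a pair (B_S, B_C), where B_S is a bilinear form on V and B_C is a symmetric bilinear form on V, lies in the image of σ₃(P₁) (i.e. there exists a symmetric trilinear form A on V with B_S(X,Y) = A(X, S, J Y) − A(X, Y, C) and B_C(X,Y) = A(X, Y, C) for all X, Y) if and only if for all X, Y ∈ V: (i) B_S(J X, P_h Y) − B_S(P_h Y, J X) − B_S(J Y, P_h X) + B_S(P_h X, J Y) = 0; (ii) B_S(X, S) = 0; (iii) B_S(X, J Y) + B_C(X, J Y) = 0; (iv) B_S(C, P_h X) − B_C(S, J X) + B_C(P_h X, C) = 0. -/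
set_option synthInstance.maxHeartbeats 1000000
set_option maxHeartbeats 1000000

noncomputable section

/-- The pointwise model `V = (Fin n → ℝ) × (Fin n → ℝ)` of the double tangent space
`T_x(TM)` for a spray on an `n`-dimensional manifold, in an adapted basis. -/
abbrev V (n : ℕ) : Type := (Fin n → ℝ) × (Fin n → ℝ)

/-- The vertical endomorphism `J (x, y) = (0, x)`. -/
def Jmap (n : ℕ) : V n →ₗ[ℝ] V n where
  toFun p := (0, p.1)
  map_add' a b := by simp
  map_smul' c a := by simp

/-- The horizontal projector `P_h (x, y) = (x, 0)`. -/
def Ph (n : ℕ) : V n →ₗ[ℝ] V n where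
  toFun p := (p.1, 0)
  map_add' a b := by simp
  map_smul' c a := by simp

/-- The `j`-th standard basis vector of `Fin n → ℝ`, indexed by `1 ≤ j ≤ n`
(zero if `j` is out of range). -/
def dlt (n j : ℕ) : Fin n → ℝ := fun i => if (i : ℕ) + 1 = j then 1 else 0

/-- The horizontal basis vector `h_j`, `1 ≤ j ≤ n`. -/
def hvec (n j : ℕ) : V n := (dlt n j, 0)

/-- The vertical basis vector `v_j`, `1 ≤ j ≤ n`. -/
def vvec (n j : ℕ) : V n := (0, dlt n j)

/-- The spray vector `S = h_n`. -/
def Svec (n : ℕ) : V n := hvec n n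

/-- The Liouville vector `C = v_n = J S`. -/
def Cvec (n : ℕ) : V n := vvec n n

/-- Bilinear forms on `V n`. -/
abbrev Bil (n : ℕ) := V n →ₗ[ℝ] V n →ₗ[ℝ] ℝ

/-- Trilinear forms on `V n` (bundled). -/
abbrev Tri (n : ℕ) := V n →ₗ[ℝ] V n →ₗ[ℝ] V n →ₗ[ℝ] ℝ

/-- A totally symmetric function that is linear in its last argument is a trilinear form. -/
lemma exists_tri (n : ℕ) (f : V n → V n → V n → ℝ)
    (h1 : ∀ X Y Z, f X Y Z = f Y X Z) (h2 : ∀ X Y Z, f X Y Z = f X Z Y)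
    (hadd : ∀ X Y Z W, f X Y (Z + W) = f X Y Z + f X Y W)
    (hsmul : ∀ (r : ℝ) X Y Z, f X Y (r • Z) = r * f X Y Z) :
    ∃ A : Tri n, ∀ X Y Z, A X Y Z = f X Y Z := by
  have h3 : ∀ X Y Z, f X Y Z = f Y Z X := fun X Y Z => by rw [h1 X Y Z, h2 Y X Z]
  refine ⟨LinearMap.mk₂ ℝ (fun X Y =>
    { toFun := fun Z => f X Y Z
      map_add' := hadd X Y
      map_smul' := fun r Z => by simp [hsmul] }) ?_ ?_ ?_ ?_, ?_⟩
  · intro X X' Y; ext1 <;> ext <;> simp [h3 _ Y, hadd]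
  · intro r X Y; ext1 <;> ext <;> simp [h3 _ Y, hsmul]
  · intro X Y Y'; ext1 <;> ext <;> simp [h2 X, hadd]
  · intro r X Y; ext1 <;> ext <;> simp [h2 X, hsmul]
  · intro X Y Z; rfl

/-- Extension of a symmetric bilinear form to a symmetric trilinear form with
prescribed contraction by `a`. -/
lemma exists_ext (n : ℕ) (α : V n →ₗ[ℝ] ℝ) (a : V n) (ha : α a = 1) (B : Bil n)
    (hB : ∀ X Y, B X Y = B Y X) :
    ∃ A : Tri n, (∀ X Y Z, A X Y Z = A Y X Z) ∧ (∀ X Y Z, A X Y Z = A X Z Y) ∧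
      (∀ Y Z, A a Y Z = B Y Z) ∧
      (∀ d, α d = 0 → (∀ Z, B d Z = 0) → ∀ Y Z, A d Y Z = 0) := by
  obtain ⟨A, hA⟩ := exists_tri n (fun X Y Z =>
      α X * B Y Z + α Y * B X Z + α Z * B X Y
      - α X * α Y * B a Z - α X * α Z * B a Y - α Y * α Z * B a X
      + α X * α Y * α Z * B a a)
    (fun X Y Z => by rw [hB X Y]; ring)
    (fun X Y Z => by rw [hB Y Z]; ring)
    (fun X Y Z W => by simp only [map_add]; ring)
    (fun r X Y Z => by simp only [map_smul, smul_eq_mul]; ring)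
  refine ⟨A, ?_, ?_, ?_, ?_⟩
  · intro X Y Z; rw [hA, hA, hB X Y]; ring
  · intro X Y Z; rw [hA, hA, hB Y Z]; ring
  · intro Y Z; rw [hA, ha]; ring
  · intro d hd hBd Y Z; rw [hA, hd, hBd, hBd, hB a d, hBd]; ring

/-- The map `(x, y) ↦ (y, 0)`. -/
def Kmap (n : ℕ) : V n →ₗ[ℝ] V n where
  toFun p := (p.2, 0)
  map_add' a b := by simp
  map_smul' c a := by simp

/-- exactness of the symbol sequence for the Rapcsák operator: a pair
`(B_S, B_C)` lies in the image of `σ₃(P₁)` iff it lies in the kernel of `τ₁`. -/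
theorem sigma3P1_exact (n : ℕ) (hn : 1 ≤ n) (BS BC : Bil n)
    (hBCsym : ∀ X Y, BC X Y = BC Y X) :
    (∃ A : Tri n,
      (∀ X Y Z, A X Y Z = A Y X Z) ∧ (∀ X Y Z, A X Y Z = A X Z Y) ∧
      (∀ X Y, BS X Y = A X (Svec n) (Jmap n Y) - A X Y (Cvec n)) ∧
      (∀ X Y, BC X Y = A X Y (Cvec n)))
    ↔
    ((∀ X Y, BS (Jmap n X) (Ph n Y) - BS (Ph n Y) (Jmap n X)
        - BS (Jmap n Y) (Ph n X) + BS (Ph n X) (Jmap n Y) = 0) ∧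
     (∀ X, BS X (Svec n) = 0) ∧
     (∀ X Y, BS X (Jmap n Y) + BC X (Jmap n Y) = 0) ∧
     (∀ X, BS (Cvec n) (Ph n X) - BC (Svec n) (Jmap n X) + BC (Ph n X) (Cvec n) = 0)) := by
  constructor
  · rintro ⟨A, h1, h2, hS, hC⟩
    have hJC : Jmap n (Svec n) = Cvec n := rfl
    have hJJ : ∀ X, Jmap n (Jmap n X) = 0 := fun X => rfl
    have hJP : ∀ X, Jmap n (Ph n X) = Jmap n X := fun X => rfl
    refine ⟨?_, ?_, ?_, ?_⟩
    · intro X Y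
      simp only [hS, hJJ, hJP, map_zero]
      rw [h2 (Jmap n X) (Svec n), h1 (Jmap n X) (Jmap n Y), h2 (Jmap n Y) (Jmap n X),
        h1 (Jmap n X) (Ph n Y), h1 (Jmap n Y) (Ph n X)]
      ring
    · intro X; rw [hS, hJC]; ring
    · intro X Y; rw [hS, hC, hJJ, map_zero]; ring
    · intro X
      rw [hS, hC, hC, hJP, h1 (Cvec n) (Svec n), h2 (Svec n) (Cvec n), h1 (Cvec n) (Ph n X)]
      ring
  · rintro ⟨hi, hii, hiii, hiv⟩
    -- coordinate functionals dual to `S` and `C`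
    let k : Fin n := ⟨n - 1, by omega⟩
    let s : V n →ₗ[ℝ] ℝ := (LinearMap.proj k).comp (LinearMap.fst ℝ _ _)
    let c : V n →ₗ[ℝ] ℝ := (LinearMap.proj k).comp (LinearMap.snd ℝ _ _)
    have hk : dlt n n k = 1 := by simp only [dlt, k]; rw [if_pos]; omega
    have hsS : s (Svec n) = 1 := hk
    have hcC : c (Cvec n) = 1 := hk
    have hsC : s (Cvec n) = 0 := rfl
    let G : Bil n := BS + BC
    have hG : ∀ X Y, G X Y = BS X Y + BC X Y := fun X Y => rfl
    have hdec : ∀ X : V n, X = Ph n X + Jmap n (Kmap n X) := by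
      intro X; ext i <;> simp [Ph, Jmap, Kmap]
    have hGP : ∀ X Y, G X (Ph n Y) = G X Y := by
      intro X Y
      conv_rhs => rw [hdec Y, map_add]
      rw [hG X (Jmap n _), hiii]; ring
    have hGsym : ∀ X Y, G (Jmap n X) Y = G (Jmap n Y) X := by
      intro X Y
      rw [← hGP _ Y, ← hGP _ X, hG, hG]
      have e1 := hi X Y
      have e2 := hiii (Ph n Y) X
      have e3 := hiii (Ph n X) Y
      rw [hBCsym (Ph n Y)] at e2
      rw [hBCsym (Ph n X)] at e3
      linarith
    have hGS : ∀ X, G X (Svec n) = BC X (Svec n) := fun X => by rw [hG, hii]; ring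
    have hGC : ∀ X, G (Cvec n) X = BC (Svec n) (Jmap n X) := by
      intro X
      rw [← hGP, hG]
      have := hiv X
      rw [hBCsym (Ph n X)] at this
      linarith
    -- symmetric extension of the form prescribed on `Vert × V`
    let D : Bil n := (G.compl₂ (Kmap n)) + (G.compl₂ (Kmap n)).flip
      - (G.compl₁₂ (Jmap n ∘ₗ Kmap n) (Kmap n))
    have hD : ∀ X Y, D X Y = G X (Kmap n Y) + G Y (Kmap n X)
      - G (Jmap n (Kmap n X)) (Kmap n Y) := fun X Y => rfl
    have hDsym : ∀ X Y, D X Y = D Y X := by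
      intro X Y; rw [hD, hD, hGsym]; ring
    have hDJ : ∀ X Y, D X (Jmap n Y) = G X Y := by
      intro X Y
      have e : Kmap n (Jmap n Y) = Ph n Y := rfl
      rw [hD, e, hGP, hGP, hGsym Y, ]
      ring
    have hDC : ∀ X, D X (Cvec n) = BC X (Svec n) := fun X => by
      rw [← hGS, ← hDJ]; rfl
    obtain ⟨A1, a1, a2, a3, -⟩ := exists_ext n c (Cvec n) hcC BC hBCsym
    have hE : ∀ X Y, (D - A1 (Svec n)) X Y = D X Y - A1 (Svec n) X Y := fun X Y => rfl
    obtain ⟨A2, b1, b2, b3, b4⟩ := exists_ext n s (Svec n) hsS (D - A1 (Svec n))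
      (fun X Y => by rw [hE, hE, hDsym, a2])
    have b5 : ∀ Y Z, A2 (Cvec n) Y Z = 0 := b4 _ hsC (fun Z => by
      rw [hE, hDsym, hDC, a1, a3, hBCsym]; ring)
    have hA : ∀ X Y Z, (A1 + A2) X Y Z = A1 X Y Z + A2 X Y Z := fun X Y Z => rfl
    have hAC : ∀ X Y, (A1 + A2) X Y (Cvec n) = BC X Y := by
      intro X Y
      rw [hA, a2, a1, a3, b2, b1, b5]; ring
    refine ⟨A1 + A2, ?_, ?_, ?_, ?_⟩
    · intro X Y Z; rw [hA, hA, a1, b1]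
    · intro X Y Z; rw [hA, hA, a2, b2]
    · intro X Y
      rw [hAC, hA, b1, b3, hE, hDJ, a1 X, hG]; ring
    · intro X Y; rw [hAC]
end
end

section
/- The prolonged symbol σ₃(P₂) of the extended Rapcsák operator has rank (4n³ + 9n² + 5n)/6; precisely, the linear map σ₃(P₂) sending a symmetric trilinear form A on V to the pair (B_Γ, B_C), where B_Γ(X,Y,Z) := 2(A(X, P_h Y, J Z) − A(X, P_h Z, J Y)) and B_C(X,Y) := A(X, Y, C), has image of dimension (4n³ + 9n² + 5n)/6. -/
set_option synthInstance.maxHeartbeats 1000000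
set_option maxHeartbeats 1000000

noncomputable section

/-- The image of the prolonged symbol `σ₃(P₂)`: pairs `(B_Γ, B_C)` coming from a
symmetric trilinear form `A` via `B_Γ(X,Y,Z) = 2(A(X, P_h Y, J Z) − A(X, P_h Z, J Y))`
and `B_C(X,Y) = A(X, Y, C)`. -/
def sigma3P2Image (n : ℕ) : Submodule ℝ ((V n → V n → V n → ℝ) × Bil n) where
  carrier := {B | ∃ A : Tri n,
    (∀ X Y Z, A X Y Z = A Y X Z) ∧ (∀ X Y Z, A X Y Z = A X Z Y) ∧
    (∀ X Y Z, B.1 X Y Z = 2 * (A X (Ph n Y) (Jmap n Z) - A X (Ph n Z) (Jmap n Y))) ∧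
    (∀ X Y, B.2 X Y = A X Y (Cvec n))}
  add_mem' := by
    rintro a b ⟨A, hA1, hA2, hA3, hA4⟩ ⟨B, hB1, hB2, hB3, hB4⟩
    refine ⟨A + B, fun X Y Z => ?_, fun X Y Z => ?_, fun X Y Z => ?_, fun X Y => ?_⟩ <;>
      simp only [Prod.fst_add, Prod.snd_add, Pi.add_apply, LinearMap.add_apply]
    · linear_combination hA1 X Y Z + hB1 X Y Z
    · linear_combination hA2 X Y Z + hB2 X Y Z
    · linear_combination hA3 X Y Z + hB3 X Y Z
    · linear_combination hA4 X Y + hB4 X Y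
  zero_mem' := ⟨0, fun X Y Z => by simp, fun X Y Z => by simp, fun X Y Z => by simp,
    fun X Y => by simp⟩
  smul_mem' := by
    rintro c a ⟨A, hA1, hA2, hA3, hA4⟩
    refine ⟨c • A, fun X Y Z => ?_, fun X Y Z => ?_, fun X Y Z => ?_, fun X Y => ?_⟩ <;>
      simp only [Prod.smul_fst, Prod.smul_snd, Pi.smul_apply, LinearMap.smul_apply,
        smul_eq_mul]
    · linear_combination c * hA1 X Y Z
    · linear_combination c * hA2 X Y Z
    · linear_combination c * hA3 X Y Z
    · linear_combination c * hA4 X Y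

/-- Symmetric arrays supported on triples of indices satisfying `p`. -/
def SymArr (ι : Type) (p : ι → Prop) : Submodule ℝ (ι → ι → ι → ℝ) where
  carrier := {f | (∀ x y z, f x y z = f y x z) ∧ (∀ x y z, f x y z = f x z y) ∧
    (∀ x y z, ¬ p z → f x y z = 0)}
  add_mem' := by
    rintro a b ⟨h1, h2, h3⟩ ⟨k1, k2, k3⟩
    refine ⟨fun x y z => ?_, fun x y z => ?_, fun x y z hz => ?_⟩ <;>
      simp only [Pi.add_apply]
    · rw [h1, k1]
    · rw [h2, k2]
    · rw [h3 _ _ _ hz, k3 _ _ _ hz, add_zero]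
  zero_mem' := ⟨fun _ _ _ => rfl, fun _ _ _ => rfl, fun _ _ _ _ => rfl⟩
  smul_mem' := by
    rintro c a ⟨h1, h2, h3⟩
    refine ⟨fun x y z => ?_, fun x y z => ?_, fun x y z hz => ?_⟩ <;>
      simp only [Pi.smul_apply]
    · rw [h1]
    · rw [h2]
    · rw [h3 _ _ _ hz, smul_zero]

/-- the multiset of three elements, as an element of `Sym α 3` -/
def sym3 {α : Type} (a b c : α) : Sym α 3 := ⟨{a, b, c}, rfl⟩

theorem sym3_swap1 {α : Type} (a b c : α) : sym3 a b c = sym3 b a c :=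
  Subtype.ext (Multiset.cons_swap a b {c})

theorem sym3_swap2 {α : Type} (a b c : α) : sym3 a b c = sym3 a c b :=
  Subtype.ext (congrArg (Multiset.cons a) (Multiset.pair_comm b c))

theorem sym3_surj {α : Type} (m : Sym α 3) : ∃ t : α × α × α, sym3 t.1 t.2.1 t.2.2 = m := by
  obtain ⟨x, y, z, h⟩ := Multiset.card_eq_three.1 m.2
  exact ⟨(x, y, z), Subtype.ext h.symm⟩

theorem sym3_inj {α : Type} {a b c a' b' c' : α} (h : sym3 a b c = sym3 a' b' c')
    (f : α → α → α → ℝ) (h1 : ∀ x y z, f x y z = f y x z) (h2 : ∀ x y z, f x y z = f x z y) :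
    f a b c = f a' b' c' := by
  have key : ∀ {u v w u' v' : α}, ({u, v} : Multiset α) = {u', v'} → f w u v = f w u' v' := by
    intro u v w u' v' e
    have hu : u ∈ ({u', v'} : Multiset α) := by rw [← e]; simp
    rcases (by simpa using hu : u = u' ∨ u = v') with rfl | rfl
    · have := (Multiset.cons_inj_right u).1 e
      rw [Multiset.singleton_inj.1 this]
    · rw [Multiset.pair_comm u' u] at e
      have := (Multiset.cons_inj_right u).1 e
      rw [Multiset.singleton_inj.1 this, h2]
  have e : ({a, b, c} : Multiset α) = {a', b', c'} := congrArg Subtype.val h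
  have ha : a ∈ ({a', b', c'} : Multiset α) := by rw [← e]; simp
  rcases (by simpa using ha : a = a' ∨ a = b' ∨ a = c') with rfl | rfl | rfl
  · exact key ((Multiset.cons_inj_right a).1 e)
  · rw [h1 a' a c']
    have e2 : ({a', a, c'} : Multiset α) = {a, a', c'} := Multiset.cons_swap _ _ _
    rw [e2] at e
    exact key ((Multiset.cons_inj_right a).1 e)
  · rw [h2 a' b' a, h1 a' a b']
    have e2 : ({a', b', a} : Multiset α) = {a, a', b'} := by
      rw [show ({a', b', a} : Multiset α) = {a', a, b'} from
        congrArg (Multiset.cons a') (Multiset.pair_comm b' a)]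
      exact Multiset.cons_swap _ _ _
    rw [e2] at e
    exact key ((Multiset.cons_inj_right a).1 e)

theorem SymArr_zero {ι : Type} {p : ι → Prop} {f : ι → ι → ι → ℝ} (hf : f ∈ SymArr ι p)
    {x y z : ι} (h : ¬ (p x ∧ p y ∧ p z)) : f x y z = 0 := by
  obtain ⟨h1, h2, h3⟩ := hf
  by_cases hz : p z
  · by_cases hy : p y
    · have hx : ¬ p x := fun hx => h ⟨hx, hy, hz⟩
      rw [h1, h2, h3 _ _ _ hx]
    · rw [h2, h3 _ _ _ hy]
  · exact h3 _ _ _ hz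

open Classical in
/-- functions on `Sym` versus symmetric arrays -/
def SymArrEquiv (ι : Type) (p : ι → Prop) : SymArr ι p ≃ₗ[ℝ] (Sym {i // p i} 3 → ℝ) where
  toFun f m := f.1 (sym3_surj m).choose.1 (sym3_surj m).choose.2.1 (sym3_surj m).choose.2.2
  map_add' a b := rfl
  map_smul' c a := rfl
  invFun g := ⟨fun x y z => if h : p x ∧ p y ∧ p z then
      g (sym3 ⟨x, h.1⟩ ⟨y, h.2.1⟩ ⟨z, h.2.2⟩) else 0, by
    refine ⟨fun x y z => ?_, fun x y z => ?_, fun x y z hz => ?_⟩ <;> beta_reduce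
    · by_cases h : p x ∧ p y ∧ p z
      · rw [dif_pos h, dif_pos ⟨h.2.1, h.1, h.2.2⟩, sym3_swap1]
      · rw [dif_neg h, dif_neg (fun k => h ⟨k.2.1, k.1, k.2.2⟩)]
    · by_cases h : p x ∧ p y ∧ p z
      · rw [dif_pos h, dif_pos ⟨h.1, h.2.2, h.2.1⟩, sym3_swap2]
      · rw [dif_neg h, dif_neg (fun k => h ⟨k.1, k.2.2, k.2.1⟩)]
    · exact dif_neg (fun k => hz k.2.2)⟩
  left_inv f := by
    apply Subtype.ext
    funext x y z
    by_cases h : p x ∧ p y ∧ p z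
    · simp only [dif_pos h]
      exact sym3_inj (sym3_surj (sym3 (⟨x, h.1⟩ : {i // p i}) ⟨y, h.2.1⟩ ⟨z, h.2.2⟩)).choose_spec
        (fun a b c => f.1 a b c) (fun a b c => f.2.1 a b c) (fun a b c => f.2.2.1 a b c)
    · simp only [dif_neg h]
      exact (SymArr_zero f.2 h).symm
  right_inv g := by
    funext m
    have hc := (sym3_surj m).choose_spec
    refine (dif_pos ⟨(sym3_surj m).choose.1.2, (sym3_surj m).choose.2.1.2,
      (sym3_surj m).choose.2.2.2⟩).trans ?_
    exact congrArg g hc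

theorem finrank_SymArr (ι : Type) [Fintype ι] (p : ι → Prop) (k : ℕ)
    (hk : Nat.card {i // p i} = k) :
    Module.finrank ℝ (SymArr ι p) = Nat.multichoose k 3 := by
  classical
  rw [(SymArrEquiv ι p).finrank_eq, Module.finrank_fintype_fun_eq_card,
    Sym.card_sym_eq_multichoose, ← hk, Nat.card_eq_fintype_card]

theorem six_multichoose (k : ℕ) : 6 * Nat.multichoose k 3 = k * (k + 1) * (k + 2) := by
  have h2 : ∀ k, 2 * Nat.multichoose k 2 = k * (k + 1) := by
    intro k
    induction k with
    | zero => simp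
    | succ k ih => rw [Nat.multichoose_succ_succ, mul_add, ih, Nat.multichoose_one_right]; ring
  induction k with
  | zero => simp
  | succ k ih =>
    rw [Nat.multichoose_succ_succ, mul_add, ih]
    linarith [h2 (k + 1), show (k + 1) * (k + 1 + 1) * 3 + k * (k + 1) * (k + 2)
      = (k + 1) * (k + 1 + 1) * (k + 1 + 2) by ring]

abbrev Idx (n : ℕ) : Type := Fin n ⊕ Fin n

/-- the adapted basis -/
def bas (n : ℕ) : Module.Basis (Idx n) ℝ (V n) := (Pi.basisFun ℝ (Fin n)).prod (Pi.basisFun ℝ (Fin n))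

/-- trilinear form from an array -/
def triOf (n : ℕ) (a : Idx n → Idx n → Idx n → ℝ) : Tri n :=
  (bas n).constr ℝ fun x => (bas n).constr ℝ fun y => (bas n).constr ℝ fun z => a x y z

theorem triOf_bas (n : ℕ) (a : Idx n → Idx n → Idx n → ℝ) (x y z : Idx n) :
    triOf n a (bas n x) (bas n y) (bas n z) = a x y z := by
  simp [triOf]

theorem tri_ext {n : ℕ} {A B : Tri n}
    (h : ∀ x y z, A (bas n x) (bas n y) (bas n z) = B (bas n x) (bas n y) (bas n z)) : A = B :=
  (bas n).ext fun x => (bas n).ext fun y => (bas n).ext fun z => h x y z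

theorem triOf_add (n : ℕ) (a b : Idx n → Idx n → Idx n → ℝ) :
    triOf n (a + b) = triOf n a + triOf n b := by
  apply tri_ext; intro x y z
  simp [triOf_bas]

theorem triOf_smul (n : ℕ) (c : ℝ) (a : Idx n → Idx n → Idx n → ℝ) :
    triOf n (c • a) = c • triOf n a := by
  apply tri_ext; intro x y z
  simp [triOf_bas]

/-- the symbol, in array form -/
def Phi (n : ℕ) : SymArr (Idx n) (fun _ => True) →ₗ[ℝ] (V n → V n → V n → ℝ) × Bil n where
  toFun a := (fun X Y Z => 2 * (triOf n a.1 X (Ph n Y) (Jmap n Z)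
      - triOf n a.1 X (Ph n Z) (Jmap n Y)),
    (triOf n a.1).compr₂ (LinearMap.applyₗ (Cvec n)))
  map_add' a b := by
    refine Prod.ext ?_ ?_
    · funext X Y Z
      simp [triOf_add]; ring
    · refine LinearMap.ext fun X => LinearMap.ext fun Y => ?_
      simp [triOf_add]
  map_smul' c a := by
    refine Prod.ext ?_ ?_
    · funext X Y Z
      simp [triOf_smul]; ring
    · refine LinearMap.ext fun X => LinearMap.ext fun Y => ?_
      simp [triOf_smul]

theorem range_Phi (n : ℕ) : LinearMap.range (Phi n) = sigma3P2Image n := by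
  ext B
  constructor
  · rintro ⟨a, rfl⟩
    refine ⟨triOf n a.1, ?_, ?_, fun _ _ _ => rfl, fun _ _ => rfl⟩
    · have : triOf n a.1 = (triOf n a.1).flip := by
        apply tri_ext; intro x y z
        rw [LinearMap.flip_apply, triOf_bas, triOf_bas]
        exact a.2.1 x y z
      intro X Y Z
      conv_lhs => rw [this]
      rfl
    · have : triOf n a.1 = (LinearMap.lflip (R₀ := ℝ)).toLinearMap ∘ₗ (triOf n a.1) := by
        apply tri_ext; intro x y z
        change _ = triOf n a.1 (bas n x) (bas n z) (bas n y)
        rw [triOf_bas, triOf_bas]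
        exact a.2.2.1 x y z
      intro X Y Z
      conv_lhs => rw [this]
      rfl
  · rintro ⟨A, h1, h2, h3, h4⟩
    have hA : triOf n (fun x y z => A (bas n x) (bas n y) (bas n z)) = A := by
      apply tri_ext; intro x y z
      rw [triOf_bas]
    refine ⟨⟨fun x y z => A (bas n x) (bas n y) (bas n z), fun _ _ _ => h1 _ _ _,
      fun _ _ _ => h2 _ _ _, fun _ _ _ h => absurd trivial h⟩, ?_⟩
    refine Prod.ext ?_ ?_
    · funext X Y Z
      rw [h3]
      simp only [Phi, LinearMap.coe_mk, AddHom.coe_mk, hA]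
    · refine LinearMap.ext fun X => LinearMap.ext fun Y => ?_
      rw [h4]
      simp only [Phi, LinearMap.coe_mk, AddHom.coe_mk, hA]
      rfl

theorem bas_inl (n : ℕ) (i : Fin n) : bas n (Sum.inl i) = (Pi.single i 1, 0) := by
  simp [bas, Module.Basis.prod_apply]

theorem bas_inr (n : ℕ) (i : Fin n) : bas n (Sum.inr i) = (0, Pi.single i 1) := by
  simp [bas, Module.Basis.prod_apply]

theorem Ph_inl (n : ℕ) (i : Fin n) : Ph n (bas n (Sum.inl i)) = bas n (Sum.inl i) := by
  simp [bas_inl, Ph]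

theorem Ph_inr (n : ℕ) (i : Fin n) : Ph n (bas n (Sum.inr i)) = 0 := by
  simp [bas_inr, Ph]

theorem J_inl (n : ℕ) (i : Fin n) : Jmap n (bas n (Sum.inl i)) = bas n (Sum.inr i) := by
  simp [bas_inl, bas_inr, Jmap]

theorem J_inr (n : ℕ) (i : Fin n) : Jmap n (bas n (Sum.inr i)) = 0 := by
  simp [bas_inr, Jmap]

theorem Cvec_eq (m : ℕ) : Cvec (m + 1) = bas (m + 1) (Sum.inr (Fin.last m)) := by
  rw [bas_inr, Cvec, vvec]
  congr 1
  funext i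
  simp [dlt, Pi.single_apply, Fin.ext_iff]

theorem mem_ker_Phi (m : ℕ) (a : SymArr (Idx (m + 1)) (fun _ => True)) :
    a ∈ LinearMap.ker (Phi (m + 1)) ↔
      (∀ x i j, a.1 x (Sum.inl i) (Sum.inr j) = a.1 x (Sum.inl j) (Sum.inr i)) ∧
      (∀ x y, a.1 x y (Sum.inr (Fin.last m)) = 0) := by
  rw [LinearMap.mem_ker]
  constructor
  · intro h
    constructor
    · intro x i j
      have := congrFun (congrFun (congrFun (congrArg Prod.fst h) (bas _ x)) (bas _ (Sum.inl i)))
        (bas _ (Sum.inl j))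
      simp only [Phi, LinearMap.coe_mk, AddHom.coe_mk, Ph_inl, J_inl, triOf_bas, Prod.fst_zero,
        Pi.zero_apply] at this
      linarith
    · intro x y
      have := LinearMap.congr_fun (LinearMap.congr_fun (congrArg Prod.snd h) (bas _ x)) (bas _ y)
      simpa [Phi, Cvec_eq, triOf_bas] using this
  · rintro ⟨h1, h2⟩
    refine Prod.ext ?_ ?_
    · funext X Y Z
      have key : (triOf (m + 1) a.1) X (Ph _ Y) (Jmap _ Z)
          = (triOf (m + 1) a.1) X (Ph _ Z) (Jmap _ Y) := by
        have hX := (bas (m + 1)).mem_span X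
        induction hX using Submodule.span_induction with
        | mem X hX =>
          obtain ⟨x, rfl⟩ := hX
          have : ((triOf (m + 1) a.1) (bas _ x)).compl₁₂ (Ph _) (Jmap _)
            = (((triOf (m + 1) a.1) (bas _ x)).compl₁₂ (Ph _) (Jmap _)).flip := by
            refine (bas _).ext fun y => (bas _).ext fun z => ?_
            simp only [LinearMap.flip_apply, LinearMap.compl₁₂_apply]
            rcases y with y | y <;> rcases z with z | z <;>
              simp [Ph_inl, Ph_inr, J_inl, J_inr, triOf_bas]
            exact h1 x y z
          exact LinearMap.congr_fun (LinearMap.congr_fun this Y) Z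
        | zero => simp
        | add u v _ _ hu hv => simp [hu, hv]
        | smul c u _ hu => simp [hu]
      simp [Phi, key]
    · refine (bas _).ext fun x => (bas _).ext fun y => ?_
      simpa [Phi, Cvec_eq, triOf_bas] using h2 x y

/-- assemble an array from its four type components -/
def glue (n : ℕ) (f0 f1 f2 f3 : Fin n → Fin n → Fin n → ℝ) : Idx n → Idx n → Idx n → ℝ
  | .inl i, .inl j, .inl k => f0 i j k
  | .inl i, .inl j, .inr k => f1 i j k
  | .inl i, .inr j, .inl k => f1 i j k
  | .inr i, .inl j, .inl k => f1 i j k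
  | .inl i, .inr j, .inr k => f2 i j k
  | .inr i, .inl j, .inr k => f2 i j k
  | .inr i, .inr j, .inl k => f2 i j k
  | .inr i, .inr j, .inr k => f3 i j k

/-- symmetric arrays vanishing on the last index -/
abbrev ZArr (m : ℕ) := SymArr (Fin (m + 1)) (fun i => i ≠ Fin.last m)

/-- the kernel -/
def kerEquiv (m : ℕ) : LinearMap.ker (Phi (m + 1)) ≃ₗ[ℝ]
    (SymArr (Fin (m + 1)) (fun _ => True) × ZArr m × ZArr m × ZArr m) where
  toFun a :=
    have ha := (mem_ker_Phi m a.1).1 a.2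
    have s1 := a.1.2.1
    have s2 := a.1.2.2.1
    (⟨fun i j k => a.1.1 (.inl i) (.inl j) (.inl k),
        fun _ _ _ => s1 _ _ _, fun _ _ _ => s2 _ _ _, fun _ _ _ h => absurd trivial h⟩,
     ⟨fun i j k => a.1.1 (.inl i) (.inl j) (.inr k),
        fun _ _ _ => s1 _ _ _, fun _ _ _ => ha.1 _ _ _, fun i j k h => by
          rw [not_not.1 h]; exact ha.2 _ _⟩,
     ⟨fun i j k => a.1.1 (.inl i) (.inr j) (.inr k),
        fun i j k => (s2 _ _ _).trans <| (s1 _ _ _).trans <| (ha.1 _ _ _).trans <|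
          (s1 _ _ _).trans (s2 _ _ _),
        fun _ _ _ => s2 _ _ _, fun i j k h => by
          rw [not_not.1 h]; exact ha.2 _ _⟩,
     ⟨fun i j k => a.1.1 (.inr i) (.inr j) (.inr k),
        fun _ _ _ => s1 _ _ _, fun _ _ _ => s2 _ _ _, fun i j k h => by
          rw [not_not.1 h]; exact ha.2 _ _⟩)
  map_add' a b := rfl
  map_smul' c a := rfl
  invFun f := ⟨⟨glue (m + 1) f.1.1 f.2.1.1 f.2.2.1.1 f.2.2.2.1, by
      obtain ⟨⟨f0, a0, b0, c0⟩, ⟨f1, a1, b1, c1⟩, ⟨f2, a2, b2, c2⟩, ⟨f3, a3, b3, c3⟩⟩ := f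
      refine ⟨?_, ?_, fun _ _ _ h => absurd trivial h⟩
      · rintro (x | x) (y | y) (z | z) <;> simp only [glue]
        all_goals first | exact a0 _ _ _ | exact a1 _ _ _ | exact a2 _ _ _ | exact a3 _ _ _
      · rintro (x | x) (y | y) (z | z) <;> simp only [glue]
        all_goals first | exact b0 _ _ _ | exact b1 _ _ _ | exact b2 _ _ _ | exact b3 _ _ _⟩, by
    rw [mem_ker_Phi]
    obtain ⟨⟨f0, a0, b0, c0⟩, ⟨f1, a1, b1, c1⟩, ⟨f2, a2, b2, c2⟩, ⟨f3, a3, b3, c3⟩⟩ := f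
    constructor
    · rintro (x | x) y z <;> simp only [glue]
      · exact b1 _ _ _
      · exact b2 _ _ _
    · rintro (x | x) (y | y) <;> simp only [glue]
      · exact c1 _ _ _ (by simp)
      · exact c2 _ _ _ (by simp)
      · exact c2 _ _ _ (by simp)
      · exact c3 _ _ _ (by simp)⟩
  left_inv a := by
    have ha := (mem_ker_Phi m a.1).1 a.2
    have s1 := a.1.2.1
    have s2 := a.1.2.2.1
    apply Subtype.ext
    apply Subtype.ext
    funext x y z
    rcases x with x | x <;> rcases y with y | y <;> rcases z with z | z <;> simp only [glue]
    · exact (ha.1 _ _ _).trans (s2 _ _ _)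
    · exact (s1 _ _ _).trans <| (ha.1 _ _ _).trans <| (s2 _ _ _).trans (s1 _ _ _)
    · exact (s2 _ _ _).trans <| (s1 _ _ _).trans <| (ha.1 _ _ _).trans <|
        (s1 _ _ _).trans <| (s2 _ _ _).trans (s1 _ _ _)
    · exact (s1 _ _ _).trans <| (ha.1 _ _ _).trans <| (s2 _ _ _).trans (s1 _ _ _)
  right_inv f := rfl

/-- the prolonged symbol `σ₃(P₂)` of the extended Rapcsák operator has
rank `(4n³ + 9n² + 5n)/6`. -/
theorem rank_sigma3P2 (n : ℕ) (hn : 1 ≤ n) :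
    Module.finrank ℝ (sigma3P2Image n) = (4 * n ^ 3 + 9 * n ^ 2 + 5 * n) / 6 := by
  rw [← range_Phi]
  have h := LinearMap.finrank_range_add_finrank_ker (K := ℝ)
    (V := SymArr (Idx n) (fun _ => True)) (V₂ := (V n → V n → V n → ℝ) × Bil n) (Phi n)
  obtain ⟨m, rfl⟩ : ∃ m, n = m + 1 := ⟨n - 1, by omega⟩
  rw [(kerEquiv m).finrank_eq, Module.finrank_prod, Module.finrank_prod, Module.finrank_prod,
    finrank_SymArr (Idx (m + 1)) _ (2 * (m + 1)) (by simp; ring),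
    finrank_SymArr (Fin (m + 1)) (fun _ => True) (m + 1) (by simp),
    finrank_SymArr (Fin (m + 1)) (fun i => i ≠ Fin.last m) m (by
      rw [Nat.card_eq_fintype_card, Fintype.card_subtype_compl]; simp)] at h
  have e1 := six_multichoose (2 * (m + 1))
  have e2 := six_multichoose (m + 1)
  have e3 := six_multichoose m
  generalize Module.finrank ℝ (LinearMap.range (Phi (m + 1))) = r at h ⊢
  have : 4 * (m + 1) ^ 3 + 9 * (m + 1) ^ 2 + 5 * (m + 1) = 6 * r := by
    zify at *
    linear_combination (-6) * h - e1 + e2 + 3 * e3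
  rw [this]
  omega
end
end
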